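/- Let D be a dissipation distance density and define R(F,Ḟ) := (1/4)∂²_{F₁²}D²(F,F)[Ḟ,Ḟ]. Then there exist an open neighborhood U of SO(3) contained in GL₊(3) and a constant c'' > 0 such that for every F ∈ U and every Ḟ ∈ ℝ^{3×3} one has R(F,Ḟ) ≥ c'' |ḞᵀF + FᵀḞ|². -/

import Mathlib

open Matrix Filter Topology

noncomputable section

attribute [local instance] Matrix.normedAddCommGroup Matrix.normedSpace

/-- Real `3 × 3` matrices. -/
abbrev Mat3 := Matrix (Fin 3) (Fin 3) ℝ

/-- Squared Frobenius norm. -/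
def frobSq (A : Mat3) : ℝ := ∑ i, ∑ j, (A i j) ^ 2

/-- Frobenius norm. -/
def frobNorm (A : Mat3) : ℝ := Real.sqrt (frobSq A)

/-- Symmetric part of a matrix. -/
def symPart (A : Mat3) : Mat3 := (2 : ℝ)⁻¹ • (A + Aᵀ)

/-- Matrices with positive determinant. -/
def GLp : Set Mat3 := {F | 0 < F.det}

/-- The special orthogonal group `SO(3)`. -/
def SO3 : Set Mat3 := {Q | Qᵀ * Q = 1 ∧ Q.det = 1}

/-- The second Fréchet derivative of `F ↦ D(F, F₂)²` at `F₁`, applied to `(G, H)`. -/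
def D2bil (D : Mat3 → Mat3 → ℝ) (F₁ F₂ G H : Mat3) : ℝ :=
  iteratedFDeriv ℝ 2 (fun F => (D F F₂) ^ 2) F₁ ![G, H]

/-- A dissipation distance density `D : GL₊(3) × GL₊(3) → [0,∞)`, satisfying
conditions (i)–(vi). -/
structure IsDissipationDensity (D : Mat3 → Mat3 → ℝ) : Prop where
  nonneg : ∀ F₁ ∈ GLp, ∀ F₂ ∈ GLp, 0 ≤ D F₁ F₂
  eq_zero : ∀ F₁ ∈ GLp, ∀ F₂ ∈ GLp, F₁ᵀ * F₁ = F₂ᵀ * F₂ → D F₁ F₂ = 0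
  pos_of_ne : ∀ F₁ ∈ GLp, ∀ F₂ ∈ GLp, F₁ᵀ * F₁ ≠ F₂ᵀ * F₂ → 0 < D F₁ F₂
  symm : ∀ F₁ ∈ GLp, ∀ F₂ ∈ GLp, D F₁ F₂ = D F₂ F₁
  triangle : ∀ F₁ ∈ GLp, ∀ F₂ ∈ GLp, ∀ F₃ ∈ GLp, D F₁ F₃ ≤ D F₁ F₂ + D F₂ F₃
  smooth : ∃ V : Set (Mat3 × Mat3), IsOpen V ∧ SO3 ×ˢ SO3 ⊆ V ∧ V ⊆ GLp ×ˢ GLp ∧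
    ContDiffOn ℝ 3 (fun p : Mat3 × Mat3 => (D p.1 p.2) ^ 2) V
  frame_indiff : ∀ Q₁ ∈ SO3, ∀ Q₂ ∈ SO3, ∀ F₁ ∈ GLp, ∀ F₂ ∈ GLp,
    D (Q₁ * F₁) (Q₂ * F₂) = D F₁ F₂
  coercive : ∃ c > (0 : ℝ), ∀ G : Mat3, c * frobSq (symPart G) ≤ D2bil D 1 1 G G

/-- The viscous dissipation potential `R(F,Ḟ) := (1/4)·∂²_{F₁²}D²(F,F)[Ḟ,Ḟ]`. -/
def Rpot (D : Mat3 → Mat3 → ℝ) (F Fdot : Mat3) : ℝ := (1 / 4 : ℝ) * D2bil D F F Fdot Fdot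

def rotX (t : ℝ) : Mat3 := !![1,0,0;0,Real.cos t,-Real.sin t;0,Real.sin t,Real.cos t]
def rotY (t : ℝ) : Mat3 := !![Real.cos t,0,-Real.sin t;0,1,0;Real.sin t,0,Real.cos t]
def rotZ (t : ℝ) : Mat3 := !![Real.cos t,-Real.sin t,0;Real.sin t,Real.cos t,0;0,0,1]
def genX : Mat3 := !![0,0,0;0,0,-1;0,1,0]
def genY : Mat3 := !![0,0,-1;0,0,0;1,0,0]
def genZ : Mat3 := !![0,-1,0;1,0,0;0,0,0]

lemma rotX_mem (t : ℝ) : rotX t ∈ SO3 := by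
  have h := Real.sin_sq_add_cos_sq t
  constructor
  · ext i j
    fin_cases i <;> fin_cases j <;>
      simp [rotX, Matrix.mul_apply, Fin.sum_univ_three] <;> linarith
  · simp [rotX, Matrix.det_fin_three]; linarith

lemma rotY_mem (t : ℝ) : rotY t ∈ SO3 := by
  have h := Real.sin_sq_add_cos_sq t
  constructor
  · ext i j
    fin_cases i <;> fin_cases j <;>
      simp [rotY, Matrix.mul_apply, Fin.sum_univ_three] <;> linarith
  · simp [rotY, Matrix.det_fin_three]; linarith

lemma rotZ_mem (t : ℝ) : rotZ t ∈ SO3 := by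
  have h := Real.sin_sq_add_cos_sq t
  constructor
  · ext i j
    fin_cases i <;> fin_cases j <;>
      simp [rotZ, Matrix.mul_apply, Fin.sum_univ_three] <;> linarith
  · simp [rotZ, Matrix.det_fin_three]; linarith

lemma hasDeriv_mat (Y : ℝ → Mat3) (Y' : Mat3) (t : ℝ)
    (h : ∀ i j, HasDerivAt (fun s => Y s i j) (Y' i j) t) : HasDerivAt Y Y' t := by
  refine hasDerivAt_pi.2 fun i => hasDerivAt_pi.2 fun j => h i j

lemma hs0 : HasDerivAt Real.sin 1 0 := by simpa using Real.hasDerivAt_sin 0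
lemma hc0 : HasDerivAt Real.cos 0 0 := by simpa using Real.hasDerivAt_cos 0
lemma hns0 : HasDerivAt (fun t => -Real.sin t) (-1) 0 := hs0.neg

lemma rotX_deriv : HasDerivAt rotX genX 0 := by
  apply hasDeriv_mat
  intro i j
  fin_cases i <;> fin_cases j <;> simp [rotX, genX] <;>
    first | exact hs0 | exact hc0 | exact hns0 | exact hasDerivAt_const _ _

lemma rotY_deriv : HasDerivAt rotY genY 0 := by
  apply hasDeriv_mat
  intro i j
  fin_cases i <;> fin_cases j <;> simp [rotY, genY] <;>
    first | exact hs0 | exact hc0 | exact hns0 | exact hasDerivAt_const _ _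

lemma rotZ_deriv : HasDerivAt rotZ genZ 0 := by
  apply hasDeriv_mat
  intro i j
  fin_cases i <;> fin_cases j <;> simp [rotZ, genZ] <;>
    first | exact hs0 | exact hc0 | exact hns0 | exact hasDerivAt_const _ _

lemma rotX_zero : rotX 0 = 1 := by
  ext i j; fin_cases i <;> fin_cases j <;> simp [rotX]
lemma rotY_zero : rotY 0 = 1 := by
  ext i j; fin_cases i <;> fin_cases j <;> simp [rotY]
lemma rotZ_zero : rotZ 0 = 1 := by
  ext i j; fin_cases i <;> fin_cases j <;> simp [rotZ]

/-- right multiplication -/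
def mulR (F : Mat3) : Mat3 →L[ℝ] Mat3 := LinearMap.toContinuousLinearMap (LinearMap.mulRight ℝ F)

lemma mulR_apply (F X : Mat3) : mulR F X = X * F := rfl

lemma GLp_open : IsOpen GLp := by
  have : Continuous fun F : Mat3 => F.det := Continuous.matrix_det continuous_id
  exact isOpen_lt continuous_const this

section abs
variable {E : Type*} [NormedAddCommGroup E] [NormedSpace ℝ E]

/-- second derivative as a bilinear form -/
def Bil (f : E → ℝ) (x G H : E) : ℝ := iteratedFDeriv ℝ 2 f x ![G, H]

lemma Bil_eq (f : E → ℝ) (x G H : E) : Bil f x G H = fderiv ℝ (fderiv ℝ f) x G H := by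
  unfold Bil
  rw [iteratedFDeriv_two_apply]
  rfl

lemma Bil_add_left (f : E → ℝ) (x G G' H : E) :
    Bil f x (G + G') H = Bil f x G H + Bil f x G' H := by
  simp [Bil_eq]

lemma Bil_add_right (f : E → ℝ) (x G H H' : E) :
    Bil f x G (H + H') = Bil f x G H + Bil f x G H' := by
  simp [Bil_eq]

lemma Bil_smul (f : E → ℝ) (x G : E) (r : ℝ) :
    Bil f x (r • G) (r • G) = r ^ 2 * Bil f x G G := by
  simp [Bil_eq]; ring

lemma Bil_smul_left (f : E → ℝ) (x G H : E) (r : ℝ) :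
    Bil f x (r • G) H = r * Bil f x G H := by
  simp [Bil_eq]

lemma Bil_symm (f : E → ℝ) (x G H : E) (hf : ContDiffAt ℝ 3 f x) :
    Bil f x G H = Bil f x H G := by
  have h : IsSymmSndFDerivAt ℝ f x := hf.isSymmSndFDerivAt (by simp; norm_num)
  rw [Bil_eq, Bil_eq, h.eq]

lemma Bil_zero (f : E → ℝ) (y : ℝ → E) (x v : E) (hf : ContDiffAt ℝ 3 f x) (hy : y 0 = x)
    (hv : HasDerivAt y v 0) (hm : ∀ t X, f (y t) ≤ f X) (H : E) : Bil f x v H = 0 := by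
  subst hy
  have h2 : HasFDerivAt (fderiv ℝ f) (fderiv ℝ (fderiv ℝ f) (y 0)) (y 0) :=
    ((hf.fderiv_right (m := 2) (by norm_num)).differentiableAt (by norm_num)).hasFDerivAt
  have h3 := h2.comp_hasDerivAt 0 hv
  have h4 : (fderiv ℝ f) ∘ y = fun _ => 0 := by
    funext t
    exact IsLocalMin.fderiv_eq_zero (Filter.Eventually.of_forall fun X => hm t X)
  rw [h4] at h3
  rw [Bil_eq, h3.unique (hasDerivAt_const _ _)]
  rfl

lemma Bil_partial (Φ : E × E → ℝ) (V : Set (E × E)) (hV : IsOpen V)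
    (hΦ : ContDiffOn ℝ 3 Φ V) (F : E) (hF : (F, F) ∈ V) :
    ContDiffAt ℝ 3 (fun X => Φ (X, F)) F ∧
    ∀ G H, Bil (fun X => Φ (X, F)) F G H = Bil Φ (F, F) (G, 0) (H, 0) := by
  have hc : ContDiffAt ℝ 3 Φ (F, F) := hΦ.contDiffAt (hV.mem_nhds hF)
  have hi : ∀ X : E, HasFDerivAt (fun X : E => (X, F)) (ContinuousLinearMap.inl ℝ E E) X :=
    fun X => hasFDerivAt_prodMk_left X F
  have hg : ContDiffAt ℝ 3 (fun X : E => (X, F)) F := contDiffAt_id.prodMk contDiffAt_const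
  refine ⟨ContDiffAt.comp (f := fun X : E => (X, F)) F hc hg, fun G H => ?_⟩
  rw [Bil_eq, Bil_eq]
  have hev : fderiv ℝ (fun X => Φ (X, F)) =ᶠ[𝓝 F]
      fun X => (fderiv ℝ Φ (X, F)).comp (ContinuousLinearMap.inl ℝ E E) := by
    have : ∀ᶠ X in 𝓝 F, (X, F) ∈ V :=
      ((hi F).continuousAt : ContinuousAt _ F).eventually (hV.mem_nhds hF)
    filter_upwards [this] with X hX
    have hx : HasFDerivAt Φ (fderiv ℝ Φ (X, F)) (X, F) :=
      ((hΦ.contDiffAt (hV.mem_nhds hX)).differentiableAt (by norm_num)).hasFDerivAt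
    exact (hx.comp X (hi X)).fderiv
  rw [hev.fderiv_eq]
  have h2 : HasFDerivAt (fderiv ℝ Φ) (fderiv ℝ (fderiv ℝ Φ) (F, F)) (F, F) :=
    ((hc.fderiv_right (m := 2) (by norm_num)).differentiableAt (by norm_num)).hasFDerivAt
  have h3 := (HasFDerivAt.comp (f := fun X : E => (X, F)) F h2 (hi F)).clm_comp
    (hasFDerivAt_const (ContinuousLinearMap.inl ℝ E E) F)
  have h4 := h3.fderiv
  simp only [Function.comp_def] at h4
  rw [h4]
  simp

lemma Bil_cont (Φ : E → ℝ) (p v : E) (hc : ContDiffAt ℝ 3 Φ p) :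
    ContinuousAt (fun z : E × E => Bil Φ z.1 z.2 z.2) (p, v) := by
  have hT : ContinuousAt (fderiv ℝ (fderiv ℝ Φ)) p :=
    ((hc.fderiv_right (m := 2) (by norm_num)).fderiv_right (m := 1) (by norm_num)).continuousAt
  have cT : ContinuousAt (fun z : E × E => fderiv ℝ (fderiv ℝ Φ) z.1) (p, v) :=
    ContinuousAt.comp (f := fun z : E × E => z.1) (x := (p, v)) hT continuousAt_fst
  simp only [Bil_eq]
  exact (cT.clm_apply continuousAt_snd).clm_apply continuousAt_snd

lemma Bil_comp (f g : E → ℝ) (e : E ≃L[ℝ] E) (x G H : E) (h : f =ᶠ[𝓝 x] g ∘ e)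
    (hf : ContDiffAt ℝ 3 f x) :
    Bil f x G H = Bil g (e x) (e G) (e H) := by
  have h' : g =ᶠ[𝓝 (e x)] f ∘ e.symm := by
    have ht : Tendsto e.symm (𝓝 (e x)) (𝓝 x) := by
      have := e.symm.continuous.tendsto (e x)
      simpa using this
    filter_upwards [ht.eventually h] with y hy
    simpa using hy.symm
  have hg : ContDiffAt ℝ 3 g (e x) := by
    refine ContDiffAt.congr_of_eventuallyEq ?_ h'
    refine ContDiffAt.comp (e x) ?_ e.symm.contDiff.contDiffAt
    simpa using hf
  rw [Bil_eq, Bil_eq]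
  have h1 : fderiv ℝ f =ᶠ[𝓝 x] fun y => (fderiv ℝ g (e y)).comp (e : E →L[ℝ] E) := by
    filter_upwards [Filter.EventuallyEq.fderiv (𝕜 := ℝ) h] with y hy
    rw [hy]
    exact e.comp_right_fderiv
  rw [h1.fderiv_eq]
  have h2 : HasFDerivAt (fderiv ℝ g) (fderiv ℝ (fderiv ℝ g) (e x)) (e x) :=
    ((hg.fderiv_right (m := 2) (by norm_num)).differentiableAt (by norm_num)).hasFDerivAt
  have h3 := (h2.comp x e.hasFDerivAt).clm_comp (hasFDerivAt_const (e : E →L[ℝ] E) x)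
  have h4 := h3.fderiv
  simp only [Function.comp_def] at h4
  rw [h4]
  simp

end abs

lemma D2bil_eq (D : Mat3 → Mat3 → ℝ) (F₁ F₂ G H : Mat3) :
    D2bil D F₁ F₂ G H = Bil (fun F => (D F F₂) ^ 2) F₁ G H := rfl

lemma snd_zero (D : Mat3 → Mat3 → ℝ) (hD : IsDissipationDensity D) (F : Mat3) (hF : F ∈ GLp)
    (hd : ContDiffAt ℝ 3 (fun X => (D X F) ^ 2) F)
    (Y : ℝ → Mat3) (A : Mat3) (hY : ∀ t, Y t ∈ SO3) (hY0 : Y 0 = 1) (hA : HasDerivAt Y A 0)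
    (H : Mat3) : Bil (fun X => (D X F) ^ 2) F (A * F) H = 0 := by
  have h1 : HasDerivAt (fun t => mulR F (Y t)) (mulR F A) 0 :=
    (mulR F).hasFDerivAt.comp_hasDerivAt 0 hA
  have e : mulR F (Y 0) = F := by simp [mulR_apply, hY0]
  refine Bil_zero _ (fun t => mulR F (Y t)) F (A * F) hd e h1 ?_ H
  intro t X
  have hQ := hY t
  have h0 : D (Y t * F) F = 0 := by
    apply hD.eq_zero
    · simpa [GLp, hQ.2] using hF
    · exact hF
    · rw [Matrix.transpose_mul, Matrix.mul_assoc, ← Matrix.mul_assoc (Y t)ᵀ, hQ.1, Matrix.one_mul]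
  simp only [mulR_apply, h0]
  rw [zero_pow two_ne_zero]
  exact sq_nonneg _

lemma skew_decomp (A : Mat3) (h : Aᵀ = -A) :
    A = A 2 1 • genX + A 2 0 • genY + A 1 0 • genZ := by
  have e : ∀ i j, A j i = - A i j := fun i j => by simpa using congrFun (congrFun h i) j
  have h0 := e 0 0
  have h1 := e 1 1
  have h2 := e 2 2
  have h3 := e 1 0
  have h4 := e 2 0
  have h5 := e 2 1
  ext i j
  fin_cases i <;> fin_cases j <;> simp [genX, genY, genZ] <;> linarith

lemma snd_skew (D : Mat3 → Mat3 → ℝ) (hD : IsDissipationDensity D) (F : Mat3) (hF : F ∈ GLp)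
    (hd : ContDiffAt ℝ 3 (fun X => (D X F) ^ 2) F) (A : Mat3) (h : Aᵀ = -A) (H : Mat3) :
    Bil (fun X => (D X F) ^ 2) F (A * F) H = 0 := by
  have hs : ∀ (r : ℝ) (B : Mat3), Bil (fun X => (D X F) ^ 2) F (B * F) H = 0 →
      Bil (fun X => (D X F) ^ 2) F ((r • B) * F) H = 0 := by
    intro r B hB
    rw [Matrix.smul_mul, Bil_smul_left, hB, mul_zero]
  rw [skew_decomp A h, Matrix.add_mul, Matrix.add_mul, Bil_add_left, Bil_add_left,
    hs _ _ (snd_zero D hD F hF hd rotX genX rotX_mem rotX_zero rotX_deriv H),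
    hs _ _ (snd_zero D hD F hF hd rotY genY rotY_mem rotY_zero rotY_deriv H),
    hs _ _ (snd_zero D hD F hF hd rotZ genZ rotZ_mem rotZ_zero rotZ_deriv H)]
  simp

lemma frobSq_smul (r : ℝ) (A : Mat3) : frobSq (r • A) = r ^ 2 * frobSq A := by
  simp [frobSq, mul_pow, Finset.mul_sum]

lemma frobSq_cont : Continuous frobSq := by
  unfold frobSq
  refine continuous_finsetSum _ fun i _ => continuous_finsetSum _ fun j _ => ?_
  exact (continuous_apply_apply i j).pow 2

lemma frobSq_pos (A : Mat3) (h : A ≠ 0) : 0 < frobSq A := by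
  by_contra hc
  apply h
  have hn : ∀ i, 0 ≤ ∑ j, (A i j) ^ 2 := fun i => Finset.sum_nonneg fun j _ => sq_nonneg _
  have h0 : frobSq A = 0 := le_antisymm (not_lt.1 hc) (Finset.sum_nonneg fun i _ => hn i)
  ext i j
  have h1 := (Finset.sum_eq_zero_iff_of_nonneg fun i _ => hn i).1 h0 i (Finset.mem_univ i)
  have h2 := (Finset.sum_eq_zero_iff_of_nonneg fun j _ => sq_nonneg (A i j)).1 h1 j (Finset.mem_univ j)
  simpa using h2

lemma near_one (D : Mat3 → Mat3 → ℝ) (hD : IsDissipationDensity D) :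
    ∃ c > (0 : ℝ), ∀ᶠ F in 𝓝 (1 : Mat3), (F ∈ GLp ∧ ContDiffAt ℝ 3 (fun X => (D X F) ^ 2) F) ∧ ∀ G : Mat3,
      c * frobSq (Gᵀ * F + Fᵀ * G) ≤ D2bil D F F G G := by
  obtain ⟨V, hV, hSV, hVG, hΦ⟩ := hD.smooth
  obtain ⟨c, hc, hco⟩ := hD.coercive
  set Φ : Mat3 × Mat3 → ℝ := fun p => (D p.1 p.2) ^ 2 with hΦd
  have h1 : ((1 : Mat3), (1 : Mat3)) ∈ V := hSV ⟨⟨by simp, by simp⟩, ⟨by simp, by simp⟩⟩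
  have hdiag : Continuous fun F : Mat3 => (F, F) := continuous_id.prodMk continuous_id
  have hev1 : ∀ᶠ F in 𝓝 (1 : Mat3), (F, F) ∈ V :=
    hdiag.continuousAt.eventually (hV.mem_nhds h1)
  have hB : ∀ F, (F, F) ∈ V → ∀ G, D2bil D F F G G =
      Bil Φ (F, F) (G, 0) (G, 0) := by
    intro F hF G
    rw [← (Bil_partial Φ V hV hΦ F hF).2 G G]
    rfl
  have hc1 : ContDiffAt ℝ 3 Φ (1, 1) := hΦ.contDiffAt (hV.mem_nhds h1)
  let K : Set Mat3 := Metric.sphere 0 1 ∩ {S | Sᵀ = S}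
  have hK : IsCompact K := (isCompact_sphere 0 1).inter_right
    (isClosed_eq (Continuous.matrix_transpose continuous_id) continuous_id)
  have hcomp : ∀ᶠ F in 𝓝 (1 : Mat3), ∀ S ∈ K, c / 8 * frobSq (Fᵀ * ((2 : ℝ) • S) * F) <
      Bil Φ (F, F) (S * F, 0) (S * F, 0) := by
    apply hK.eventually_forall_of_forall_eventually
    intro S hS
    have hS0 : S ≠ 0 := by
      rintro rfl
      have := hS.1
      simp at this
    have cF : Continuous fun z : Mat3 × Mat3 => z.2 * z.1 :=
      Continuous.matrix_mul continuous_snd continuous_fst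
    have cL : ContinuousAt (fun z : Mat3 × Mat3 =>
        c / 8 * frobSq (z.1ᵀ * ((2 : ℝ) • z.2) * z.1)) (1, S) := by
      apply Continuous.continuousAt
      refine continuous_const.mul (frobSq_cont.comp ?_)
      exact ((continuous_fst.matrix_transpose).matrix_mul
        (continuous_snd.const_smul (2 : ℝ))).matrix_mul continuous_fst
    have cm : Continuous (fun z : Mat3 × Mat3 => ((z.1, z.1), (z.2 * z.1, (0 : Mat3)))) :=
      (hdiag.comp continuous_fst).prodMk (cF.prodMk continuous_const)
    have cB := Bil_cont Φ (1, 1) (S * 1, (0 : Mat3)) hc1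
    have cR : ContinuousAt (fun z : Mat3 × Mat3 =>
        Bil Φ (z.1, z.1) (z.2 * z.1, (0 : Mat3)) (z.2 * z.1, (0 : Mat3))) (1, S) :=
      ContinuousAt.comp (f := fun z : Mat3 × Mat3 => ((z.1, z.1), (z.2 * z.1, (0 : Mat3))))
        (x := (1, S)) cB cm.continuousAt
    refine cL.eventually_lt cR ?_
    have h2 := hco S
    rw [hB 1 h1 S] at h2
    have h3 : symPart S = S := by
      have : Sᵀ = S := hS.2
      rw [symPart, this, ← two_smul ℝ S, smul_smul]; norm_num
    rw [h3] at h2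
    simp only [Matrix.transpose_one, Matrix.one_mul, Matrix.mul_one, frobSq_smul]
    have := mul_pos hc (frobSq_pos S hS0)
    nlinarith
  refine ⟨c / 8, by positivity, ?_⟩
  filter_upwards [hev1, hcomp] with F hFV hF
  have hFG : F ∈ GLp := (hVG hFV).1
  refine ⟨⟨hFG, (Bil_partial Φ V hV hΦ F hFV).1⟩, fun G => ?_⟩
  have hu : IsUnit F.det := (ne_of_gt hFG).isUnit
  obtain ⟨hcd, hps⟩ := Bil_partial Φ V hV hΦ F hFV
  -- symmetric case
  have hsymm : ∀ S : Mat3, Sᵀ = S → c / 8 * frobSq (Fᵀ * ((2 : ℝ) • S) * F) ≤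
      Bil Φ (F, F) (S * F, 0) (S * F, 0) := by
    intro S hS
    by_cases hS0 : S = 0
    · subst hS0
      have : ((0 : Mat3) * F, (0 : Mat3)) = (0 : ℝ) • ((0 : Mat3), (0 : Mat3)) := by simp
      rw [this, Bil_smul]
      simp [frobSq]
    · have hn : ‖S‖ ≠ 0 := norm_ne_zero_iff.2 hS0
      have hm : (‖S‖⁻¹ • S) ∈ K := by
        refine ⟨?_, ?_⟩
        · simp [norm_smul, hn]
        · simp [Matrix.transpose_smul, hS]
      have h5 := (hF _ hm).le
      have e1 : Fᵀ * ((2 : ℝ) • (‖S‖⁻¹ • S)) * F = ‖S‖⁻¹ • (Fᵀ * ((2 : ℝ) • S) * F) := by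
        rw [smul_comm, Matrix.mul_smul, Matrix.smul_mul]
      have e2 : ((‖S‖⁻¹ • S) * F, (0 : Mat3)) = ‖S‖⁻¹ • (S * F, (0 : Mat3)) := by
        simp [Matrix.smul_mul]
      rw [e1, e2, frobSq_smul, Bil_smul] at h5
      have hp : 0 < ‖S‖⁻¹ ^ 2 := by positivity
      refine le_of_mul_le_mul_left ?_ hp
      linarith
  set H := G * F⁻¹ with hH
  have hG : G = H * F := by rw [hH, Matrix.nonsing_inv_mul_cancel_right _ _ hu]
  set S : Mat3 := (2 : ℝ)⁻¹ • (H + Hᵀ) with hSd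
  set A : Mat3 := (2 : ℝ)⁻¹ • (H - Hᵀ) with hAd
  have hHSA : H = S + A := by
    rw [hSd, hAd, ← smul_add]
    have : H + Hᵀ + (H - Hᵀ) = (2 : ℝ) • H := by rw [two_smul]; abel
    rw [this, smul_smul]; norm_num
  have hSs : Sᵀ = S := by
    rw [hSd, Matrix.transpose_smul, Matrix.transpose_add, Matrix.transpose_transpose, add_comm]
  have hAs : Aᵀ = -A := by
    rw [hAd, Matrix.transpose_smul, Matrix.transpose_sub, Matrix.transpose_transpose, ← smul_neg,
      neg_sub]
  have hlhs : Gᵀ * F + Fᵀ * G = Fᵀ * ((2 : ℝ) • S) * F := by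
    have : (2 : ℝ) • S = H + Hᵀ := by rw [hSd, smul_smul]; norm_num
    rw [this, hG, Matrix.transpose_mul]
    noncomm_ring
  have hz1 : ∀ X, Bil (fun X => Φ (X, F)) F (A * F) X = 0 :=
    fun X => snd_skew D hD F hFG hcd A hAs X
  have hz2 : ∀ X, Bil (fun X => Φ (X, F)) F X (A * F) = 0 := by
    intro X
    rw [Bil_symm _ _ _ _ hcd, hz1]
  have key : D2bil D F F G G = Bil Φ (F, F) (S * F, 0) (S * F, 0) := by
    rw [hB F hFV, ← hps, ← hps]
    have : G = S * F + A * F := by rw [← Matrix.add_mul, ← hHSA, hG]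
    rw [this, Bil_add_right, hz2, add_zero, Bil_add_left, hz1, add_zero]
  rw [hlhs, key]
  exact hsymm S hSs

lemma SO3_mul_transpose (Q : Mat3) (hQ : Q ∈ SO3) : Q * Qᵀ = 1 :=
  mul_eq_one_comm.1 hQ.1

def mulLE (Q : Mat3) (hQ : Q ∈ SO3) : Mat3 ≃L[ℝ] Mat3 :=
  LinearEquiv.toContinuousLinearEquiv
    (LinearEquiv.ofLinearMap (LinearMap.mulLeft ℝ Q) (LinearMap.mulLeft ℝ Qᵀ)
      (by ext1 X; simp [← Matrix.mul_assoc, SO3_mul_transpose Q hQ])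
      (by ext1 X; simp [← Matrix.mul_assoc, hQ.1]))

lemma mulLE_apply (Q : Mat3) (hQ : Q ∈ SO3) (X : Mat3) : mulLE Q hQ X = Q * X := rfl

lemma D2_frame (D : Mat3 → Mat3 → ℝ) (hD : IsDissipationDensity D) (Q : Mat3) (hQ : Q ∈ SO3)
    (F : Mat3) (hF : F ∈ GLp) (G : Mat3)
    (hc : ContDiffAt ℝ 3 (fun X => (D X (Q * F)) ^ 2) (Q * F)) :
    D2bil D (Q * F) (Q * F) (Q * G) (Q * G) = D2bil D F F G G := by
  have hev : (fun X => (D X F) ^ 2) =ᶠ[𝓝 F] (fun X => (D X (Q * F)) ^ 2) ∘ (mulLE Q hQ) := by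
    filter_upwards [GLp_open.mem_nhds hF] with X hX
    simp only [Function.comp, mulLE_apply]
    rw [hD.frame_indiff Q hQ Q hQ X hX F hF]
  have hcf : ContDiffAt ℝ 3 (fun X => (D X F) ^ 2) F :=
    ContDiffAt.congr_of_eventuallyEq
      (ContDiffAt.comp F hc (mulLE Q hQ).contDiff.contDiffAt) hev
  rw [D2bil_eq, D2bil_eq, Bil_comp _ _ (mulLE Q hQ) F G G hev hcf]
  rfl

/-- There exist an open neighborhood `U` of `SO(3)` inside `GL₊(3)` and a
constant `c'' > 0` such that `R(F,Ḟ) ≥ c'' |ḞᵀF + FᵀḞ|²` for every `F ∈ U`, `Ḟ ∈ ℝ^{3×3}`. -/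
theorem statement3 (D : Mat3 → Mat3 → ℝ) (hD : IsDissipationDensity D) :
    ∃ U : Set Mat3, IsOpen U ∧ SO3 ⊆ U ∧ U ⊆ GLp ∧
      ∃ c'' > (0 : ℝ), ∀ F ∈ U, ∀ Fdot : Mat3,
        c'' * frobSq (Fdotᵀ * F + Fᵀ * Fdot) ≤ Rpot D F Fdot := by
  obtain ⟨c, hc, hev⟩ := near_one D hD
  obtain ⟨N, hN, hNo, h1N⟩ := eventually_nhds_iff.1 hev
  refine ⟨{F | ∃ Q ∈ SO3, Q * F ∈ N}, ?_, ?_, ?_, c / 4, by positivity, ?_⟩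
  · have : {F : Mat3 | ∃ Q ∈ SO3, Q * F ∈ N} = ⋃ Q ∈ SO3, (fun F => Q * F) ⁻¹' N := by
      ext F; simp
    rw [this]
    exact isOpen_biUnion fun Q _ => hNo.preimage (Continuous.matrix_mul continuous_const continuous_id)
  · intro Q hQ
    refine ⟨Qᵀ, ⟨?_, ?_⟩, ?_⟩
    · rw [Matrix.transpose_transpose, SO3_mul_transpose Q hQ]
    · rw [Matrix.det_transpose, hQ.2]
    · rw [hQ.1]; exact h1N
  · rintro F ⟨Q, hQ, hF⟩
    have := (hN _ hF).1.1
    simpa [GLp, hQ.2] using this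
  · rintro F ⟨Q, hQ, hF⟩ G
    obtain ⟨⟨h1, h1c⟩, h2⟩ := hN _ hF
    have hFG : F ∈ GLp := by simpa [GLp, hQ.2] using h1
    have h3 := h2 (Q * G)
    rw [D2_frame D hD Q hQ F hFG G h1c] at h3
    have e : ∀ X Y : Mat3, (Q * X)ᵀ * (Q * Y) = Xᵀ * Y := by
      intro X Y
      rw [Matrix.transpose_mul, Matrix.mul_assoc, ← Matrix.mul_assoc Qᵀ, hQ.1, Matrix.one_mul]
    rw [e, e] at h3
    unfold Rpot
    linarith
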